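/- As x → ∞, ∫_1^{x^{1/4}} {t}·f₁′(t) dt = 6^{1/3}·(ζ(1/3) + 1/2)·x^{1/3} + O(x^{1/4}), where f₁′ denotes the derivative of f₁ with respect to t. -/

import Mathlib

open Real Filter Asymptotics

/-- f₁(t) = t·[(3x/t⁴ + √((3x/t⁴)² − 1/27))^{1/3} + (3x/t⁴ − √((3x/t⁴)² − 1/27))^{1/3}]. -/
noncomputable def f1 (x t : ℝ) : ℝ :=
  t * ((3 * x / t ^ 4 + Real.sqrt ((3 * x / t ^ 4) ^ 2 - 1/27)) ^ ((1:ℝ)/3)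
    + (3 * x / t ^ 4 - Real.sqrt ((3 * x / t ^ 4) ^ 2 - 1/27)) ^ ((1:ℝ)/3))

open Set MeasureTheory Topology

/-- The fractional part on `(1, ∞)`, extended by zero. -/
noncomputable def fractTail : ℝ → ℂ := (Ioi (1 : ℝ)).indicator fun t ↦ ((Int.fract t : ℝ) : ℂ)

lemma measurable_fractTail : Measurable fractTail :=
  (Complex.measurable_ofReal.comp measurable_fract).indicator measurableSet_Ioi

lemma norm_fractTail_le_one (t : ℝ) : ‖fractTail t‖ ≤ 1 := by
  unfold fractTail
  refine (norm_indicator_le_norm_self _ _).trans ?_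
  rw [Complex.norm_real, Real.norm_of_nonneg (Int.fract_nonneg t)]
  exact (Int.fract_lt_one t).le

lemma locallyIntegrableOn_fractTail : LocallyIntegrableOn fractTail (Ioi 0) := by
  refine LocallyIntegrable.locallyIntegrableOn ?_ _
  refine (locallyIntegrable_const (1 : ℝ)).mono measurable_fractTail.aestronglyMeasurable ?_
  filter_upwards with t using by simpa using norm_fractTail_le_one t

lemma fractTail_isBigO_atTop : fractTail =O[atTop] (· ^ (-(0 : ℝ))) :=
  IsBigO.of_bound 1 (Eventually.of_forall fun t ↦ by simpa using norm_fractTail_le_one t)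

lemma fractTail_isBigO_zero (b : ℝ) : fractTail =O[𝓝[>] 0] (· ^ (-b)) := by
  refine IsBigO.of_bound 1 ?_
  filter_upwards [nhdsWithin_le_nhds (Iio_mem_nhds (zero_lt_one' ℝ))] with t ht
  have : fractTail t = 0 := indicator_of_notMem (by simpa using le_of_lt ht) _
  simp [this]

lemma differentiableAt_mellin_fractTail {s : ℂ} (hs : s.re < 0) :
    DifferentiableAt ℂ (mellin fractTail) s :=
  mellin_differentiableAt_of_isBigO_rpow locallyIntegrableOn_fractTail fractTail_isBigO_atTop hs
    (fractTail_isBigO_zero (s.re - 1)) (by linarith)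

lemma mellin_fractTail (s : ℂ) :
    mellin fractTail s = ∫ t in Ioi (1 : ℝ), (t : ℂ) ^ (s - 1) * ((Int.fract t : ℝ) : ℂ) := by
  have h : (fun t : ℝ ↦ (t : ℂ) ^ (s - 1) • fractTail t) =
      (Ioi (1 : ℝ)).indicator fun t ↦ (t : ℂ) ^ (s - 1) * ((Int.fract t : ℝ) : ℂ) := by
    ext t
    by_cases ht : t ∈ Ioi (1 : ℝ) <;> simp [fractTail, ht]
  rw [mellin, h, setIntegral_indicator measurableSet_Ioi,
    inter_eq_self_of_subset_right (Ioi_subset_Ioi zero_le_one)]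

lemma integrableOn_cpow_mul_fract {s : ℂ} (hs : s.re < 0) :
    IntegrableOn (fun t : ℝ ↦ (t : ℂ) ^ (s - 1) * ((Int.fract t : ℝ) : ℂ)) (Ioi 1) := by
  have h : IntegrableOn (fun t : ℝ ↦ (t : ℂ) ^ (s - 1)) (Ioi 1) :=
    integrableOn_Ioi_cpow_of_lt (by simp; linarith) zero_lt_one
  refine h.mul_bdd (c := 1) (by fun_prop) ?_
  filter_upwards with t
  rw [Complex.norm_real, Real.norm_of_nonneg (Int.fract_nonneg t)]
  exact (Int.fract_lt_one t).le

lemma riemannZeta_eq_sub_mellin_of_one_lt_re {s : ℂ} (hs : 1 < s.re) :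
    riemannZeta s = s / (s - 1) - s * mellin fractTail (-s) := by
  have h1 : s - 1 ≠ 0 := by
    intro h
    rw [sub_eq_zero.mp h] at hs
    simp at hs
  rw [← LSeries_one_eq_riemannZeta hs, LSeries_eq_mul_integral' 1 zero_le_one (by simpa using hs)
    (by simpa using isBigO_refl _ _)]
  have hi : IntegrableOn (fun t : ℝ ↦ (t : ℂ) ^ (-s)) (Ioi 1) :=
    integrableOn_Ioi_cpow_of_lt (by simpa using hs) zero_lt_one
  have h : ∫ t in Ioi (1 : ℝ), (∑ k ∈ Finset.Icc 1 ⌊t⌋₊, (1 : ℕ → ℂ) k) * (t : ℂ) ^ (-(s + 1)) =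
      (∫ t in Ioi (1 : ℝ), (t : ℂ) ^ (-s)) - mellin fractTail (-s) := by
    rw [mellin_fractTail, ← integral_sub hi (integrableOn_cpow_mul_fract (by rw [Complex.neg_re]; linarith))]
    refine setIntegral_congr_fun measurableSet_Ioi fun t ht ↦ ?_
    have ht0 : (0 : ℝ) < t := zero_lt_one.trans ht
    have hf : ((⌊t⌋₊ : ℝ) : ℂ) = t - ((Int.fract t : ℝ) : ℂ) := by
      rw [← Complex.ofReal_sub, Int.self_sub_fract, natCast_floor_eq_intCast_floor ht0.le]
    have hp : (t : ℂ) ^ (-s) = (t : ℂ) ^ (-s - 1) * t := by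
      rw [Complex.cpow_sub _ _ (by exact_mod_cast ht0.ne'), Complex.cpow_one,
        div_mul_cancel₀ _ (by exact_mod_cast ht0.ne')]
    simp only [Pi.one_apply, Finset.sum_const, Nat.card_Icc, add_tsub_cancel_right, nsmul_eq_mul,
      mul_one]
    rw [hp, ← Complex.ofReal_natCast, hf, neg_add']
    ring
  rw [h, integral_Ioi_cpow_of_lt (by simpa using hs) zero_lt_one, Complex.ofReal_one,
    Complex.one_cpow, show -s + 1 = -(s - 1) by ring, neg_div_neg_eq]
  ring

open ZetaAsymptotics in
lemma riemannZeta_eq_sub_mellin {s : ℂ} (hs : 0 < s.re) (hs1 : s ≠ 1) :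
    riemannZeta s = s / (s - 1) - s * mellin fractTail (-s) := by
  have hU : IsOpen {z : ℂ | 0 < z.re} := isOpen_lt continuous_const Complex.continuous_re
  have hd : DifferentiableOn ℂ (fun z ↦ z - (z - 1) * (z * mellin fractTail (-z)))
      {z : ℂ | 0 < z.re} := by
    intro z hz
    have hm : DifferentiableAt ℂ (fun z ↦ mellin fractTail (-z)) z :=
      (differentiableAt_mellin_fractTail (s := -z) (by simpa using hz)).comp z differentiable_neg.differentiableAt
    exact DifferentiableAt.differentiableWithinAt (by fun_prop)
  have he : riemannZeta₁ =ᶠ[𝓝 2] fun z ↦ z - (z - 1) * (z * mellin fractTail (-z)) := by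
    have : {z : ℂ | 1 < z.re} ∈ 𝓝 (2 : ℂ) :=
      (isOpen_lt continuous_const Complex.continuous_re).mem_nhds (by simp)
    filter_upwards [this] with z hz
    have hz1 : z ≠ 1 := by rintro rfl; simp at hz
    have hz2 := sub_ne_zero.mpr hz1
    have := riemannZeta_eq_sub_mellin_of_one_lt_re hz
    rw [riemannZeta_eq_inv_sub_mul hz1] at this
    field_simp at this
    linear_combination this
  have key := (differentiable_riemannZeta₁.differentiableOn.analyticOnNhd hU)
    |>.eqOn_of_preconnected_of_eventuallyEq (hd.analyticOnNhd hU)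
      (convex_halfSpace_re_gt 0).isPreconnected (by simp) he hs
  have hs2 := sub_ne_zero.mpr hs1
  rw [riemannZeta_eq_inv_sub_mul hs1, key]
  field_simp

lemma riemannZeta_one_third_re :
    (riemannZeta (1 / 3)).re =
      -(1 / 2) - 1 / 3 * ∫ t in Ioi (1 : ℝ), Int.fract t * t ^ (-(4 / 3) : ℝ) := by
  rw [riemannZeta_eq_sub_mellin (by norm_num) (by norm_num), mellin_fractTail]
  have : ∫ t in Ioi (1 : ℝ), (t : ℂ) ^ (-(1 / 3) - 1 : ℂ) * ((Int.fract t : ℝ) : ℂ) =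
      ((∫ t in Ioi (1 : ℝ), Int.fract t * t ^ (-(4 / 3) : ℝ) : ℝ) : ℂ) := by
    rw [← integral_complex_ofReal]
    refine setIntegral_congr_fun measurableSet_Ioi fun t ht ↦ ?_
    have ht0 : (0 : ℝ) < t := zero_lt_one.trans ht
    simp only [Complex.ofReal_mul, Complex.ofReal_cpow ht0.le]
    rw [mul_comm]
    norm_num
  rw [this, show (1 / 3 : ℂ) / (1 / 3 - 1) - 1 / 3 * _ = ((-(1 / 2) - 1 / 3 *
    ∫ t in Ioi (1 : ℝ), Int.fract t * t ^ (-(4 / 3) : ℝ) : ℝ) : ℂ) by push_cast; ring,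
    Complex.ofReal_re]

lemma rpow_one_third_pow_three {a : ℝ} (ha : 0 ≤ a) : (a ^ ((1 : ℝ) / 3)) ^ 3 = a := by
  rw [← rpow_natCast, ← rpow_mul ha]
  norm_num

lemma three_halves_le_div_pow_four {x t : ℝ} (ht : 0 < t) (hx : t ^ 4 ≤ 2 * x) : 3 / 2 ≤ 3 * x / t ^ 4 := by
  rw [le_div_iff₀ (by positivity)]
  linarith

lemma sqrt_sq_sub_lt {u : ℝ} (hu : 0 < u) : √(u ^ 2 - 1 / 27) < u := by
  rw [Real.sqrt_lt' hu]
  linarith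

lemma f1_pos {x t : ℝ} (ht : 0 < t) (hx : t ^ 4 ≤ 2 * x) : 0 < f1 x t := by
  have hu := three_halves_le_div_pow_four ht hx
  have hs := sqrt_sq_sub_lt (u := 3 * x / t ^ 4) (by linarith)
  have hs0 := Real.sqrt_nonneg ((3 * x / t ^ 4) ^ 2 - 1 / 27)
  have h1 := rpow_pos_of_pos (sub_pos.mpr hs) ((1 : ℝ) / 3)
  have h2 : 0 < 3 * x / t ^ 4 + √((3 * x / t ^ 4) ^ 2 - 1 / 27) := by linarith
  have h3 := rpow_pos_of_pos h2 ((1 : ℝ) / 3)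
  exact mul_pos ht (add_pos h3 h1)

/-- Cardano's formula: `f1 x t` is a root of `X³ - t² X = 6x/t`. -/
lemma f1_cubic {x t : ℝ} (ht : 0 < t) (hx : t ^ 4 ≤ 2 * x) :
    f1 x t ^ 3 - t ^ 2 * f1 x t = 6 * x / t := by
  have hu := three_halves_le_div_pow_four ht hx
  unfold f1
  have hut : 6 * x / t = 2 * (3 * x / t ^ 4) * t ^ 3 := by field
  rw [hut]
  generalize 3 * x / t ^ 4 = u at *
  have hs := sqrt_sq_sub_lt (u := u) (by linarith)
  have hs0 := Real.sqrt_nonneg (u ^ 2 - 1 / 27)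
  have hsq := Real.sq_sqrt (show 0 ≤ u ^ 2 - 1 / 27 by nlinarith)
  generalize √(u ^ 2 - 1 / 27) = r at *
  have hA := rpow_one_third_pow_three (a := u + r) (by linarith)
  have hB := rpow_one_third_pow_three (a := u - r) (by linarith)
  have hAB : (u + r) ^ ((1 : ℝ) / 3) * (u - r) ^ ((1 : ℝ) / 3) = 1 / 3 := by
    rw [← mul_rpow (by linarith) (by linarith),
      show (u + r) * (u - r) = (1 / 3 : ℝ) ^ (3 : ℝ) by norm_num; linarith, ← rpow_mul (by norm_num)]
    norm_num
  generalize (u + r) ^ ((1 : ℝ) / 3) = A at *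
  generalize (u - r) ^ ((1 : ℝ) / 3) = B at *
  linear_combination t ^ 3 * (hA + hB + 3 * (A + B) * hAB)

lemma differentiableAt_f1 {x t : ℝ} (ht : 0 < t) (hx : t ^ 4 ≤ 2 * x) :
    DifferentiableAt ℝ (f1 x) t := by
  have hu := three_halves_le_div_pow_four ht hx
  have hs := sqrt_sq_sub_lt (u := 3 * x / t ^ 4) (by linarith)
  have hs0 := Real.sqrt_nonneg ((3 * x / t ^ 4) ^ 2 - 1 / 27)
  have hd : DifferentiableAt ℝ (fun t ↦ 3 * x / t ^ 4) t := by
    fun_prop (disch := positivity)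
  have hr : DifferentiableAt ℝ (fun t ↦ √((3 * x / t ^ 4) ^ 2 - 1 / 27)) t :=
    ((hd.pow 2).sub_const _).sqrt (by simp only [Pi.pow_apply]; nlinarith)
  exact differentiableAt_id.mul
    (((hd.add hr).rpow_const (Or.inl (by simp only [Pi.add_apply]; linarith))).add
      ((hd.sub hr).rpow_const (Or.inl (by simp only [Pi.sub_apply]; linarith))))

lemma deriv_f1_mul {x t : ℝ} (ht : 0 < t) (hx : t ^ 4 < 2 * x) :
    deriv (f1 x) t * (3 * f1 x t ^ 2 - t ^ 2) * t = f1 x t * (3 * t ^ 2 - f1 x t ^ 2) := by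
  have hd := (differentiableAt_f1 ht hx.le).hasDerivAt
  have h1 := (hd.pow 3).sub (((hasDerivAt_id t).pow 2).mul hd)
  have h2 := (hasDerivAt_const t (6 * x)).div (hasDerivAt_id t) ht.ne'
  have he : (fun t ↦ 6 * x / t) =ᶠ[𝓝 t] fun t ↦ f1 x t ^ 3 - t ^ 2 * f1 x t := by
    have hc : ContinuousAt (fun s : ℝ ↦ s ^ 4) t := by fun_prop
    filter_upwards [Ioi_mem_nhds ht, hc.eventually_lt_const hx] with s hs hsx
      using (f1_cubic hs hsx.le).symm
  have h3 := h1.unique (h2.congr_of_eventuallyEq he.symm)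
  have h4 := f1_cubic ht hx.le
  simp at h3
  field_simp at h3 h4
  have : (deriv (f1 x) t * (3 * f1 x t ^ 2 - t ^ 2) * t - f1 x t * (3 * t ^ 2 - f1 x t ^ 2)) * t
      = 0 := by
    linear_combination h3 + h4
  have := (mul_eq_zero.mp this).resolve_right ht.ne'
  linarith

/-- The leading term of `f1 x t` has derivative `-F/(3t)`, where `F³ = 6x/t`. -/
lemma abs_deriv_f1_add_le {x t F : ℝ} (ht : 0 < t) (hx : t ^ 4 < 2 * x) (hF0 : 0 < F)
    (hF : F ^ 3 = 6 * x / t) : |deriv (f1 x) t + F / (3 * t)| ≤ 2 := by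
  have h1 := deriv_f1_mul ht hx
  have h2 := f1_cubic ht hx.le
  have h3 := f1_pos ht hx.le
  rw [← hF] at h2
  have hFt : t ≤ F := by
    refine le_of_pow_le_pow_left₀ three_ne_zero hF0.le ?_
    rw [hF, le_div_iff₀ ht]
    nlinarith [pow_pos ht 4]
  generalize f1 x t = f at *
  generalize deriv (f1 x) t = d at *
  have hfF : F ≤ f := by
    refine le_of_pow_le_pow_left₀ three_ne_zero h3.le ?_
    nlinarith [mul_pos (pow_pos ht 2) h3]
  have htf := hFt.trans hfF
  have hq : 0 < 3 * f ^ 2 - t ^ 2 := by nlinarith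
  have e1 : d + f / (3 * t) = 8 * t * f / (3 * (3 * f ^ 2 - t ^ 2)) := by
    rw [eq_div_iff (by positivity)]
    field_simp
    linear_combination 3 * h1
  have e2 : (f - F) / (3 * t) = t * f / (3 * (f ^ 2 + f * F + F ^ 2)) := by
    rw [div_eq_div_iff (by positivity) (by positivity)]
    linear_combination 3 * h2
  have b1 : 8 * t * f / (3 * (3 * f ^ 2 - t ^ 2)) ≤ 2 := by
    rw [div_le_iff₀ (by positivity)]
    nlinarith
  have b2 : t * f / (3 * (f ^ 2 + f * F + F ^ 2)) ≤ 2 := by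
    rw [div_le_iff₀ (by positivity)]
    nlinarith [mul_pos h3 hF0]
  have p1 : 0 ≤ 8 * t * f / (3 * (3 * f ^ 2 - t ^ 2)) := by positivity
  have p2 : 0 ≤ t * f / (3 * (f ^ 2 + f * F + F ^ 2)) := by positivity
  have e3 : d + F / (3 * t) = 8 * t * f / (3 * (3 * f ^ 2 - t ^ 2)) -
      t * f / (3 * (f ^ 2 + f * F + F ^ 2)) := by
    rw [← e1, ← e2]
    ring
  rw [e3, abs_le]
  constructor <;> linarith

lemma integrableOn_fract_mul_rpow {a p : ℝ} (ha : 0 < a) (hp : p < -1) :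
    IntegrableOn (fun t : ℝ ↦ Int.fract t * t ^ p) (Ioi a) := by
  refine (integrableOn_Ioi_rpow_of_lt hp ha).bdd_mul (c := 1)
    measurable_fract.aestronglyMeasurable ?_
  filter_upwards with t
  rw [Real.norm_of_nonneg (Int.fract_nonneg t)]
  exact (Int.fract_lt_one t).le

lemma abs_integral_Ioi_fract_mul_rpow_le {a : ℝ} (ha : 0 < a) :
    |∫ t in Ioi a, Int.fract t * t ^ (-(4 / 3) : ℝ)| ≤ 3 * a ^ (-(1 / 3) : ℝ) := by
  have hi := integral_Ioi_rpow_of_lt (a := -(4 / 3)) (by norm_num) ha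
  rw [show (-(4 / 3) + 1 : ℝ) = -(1 / 3) by norm_num] at hi
  calc |∫ t in Ioi a, Int.fract t * t ^ (-(4 / 3) : ℝ)|
      ≤ ∫ t in Ioi a, t ^ (-(4 / 3) : ℝ) := by
        rw [← Real.norm_eq_abs]
        refine norm_integral_le_of_norm_le (integrableOn_Ioi_rpow_of_lt (by norm_num) ha) ?_
        filter_upwards [ae_restrict_mem measurableSet_Ioi] with t ht
        have h := rpow_nonneg (ha.trans ht).le (-(4 / 3))
        rw [norm_mul, Real.norm_of_nonneg (Int.fract_nonneg t), Real.norm_of_nonneg h]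
        exact mul_le_of_le_one_left h (Int.fract_lt_one t).le
    _ = 3 * a ^ (-(1 / 3) : ℝ) := by
        rw [hi]
        ring

lemma abs_deriv_f1_add_rpow_le {x t : ℝ} (ht : 0 < t) (hx : t ^ 4 ≤ x) :
    |deriv (f1 x) t + 1 / 3 * (6 * x) ^ ((1 : ℝ) / 3) * t ^ (-(4 / 3) : ℝ)| ≤ 2 := by
  have hx0 : 0 < x := (pow_pos ht 4).trans_le hx
  have hF : (6 * x / t) ^ ((1 : ℝ) / 3) / (3 * t) =
      1 / 3 * (6 * x) ^ ((1 : ℝ) / 3) * t ^ (-(4 / 3) : ℝ) := by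
    rw [div_rpow (by positivity) ht.le, show (-(4 / 3) : ℝ) = -(1 / 3 + 1) by norm_num,
      rpow_neg ht.le, rpow_add_one ht.ne']
    field
  rw [← hF]
  exact abs_deriv_f1_add_le ht (by linarith) (by positivity)
    (rpow_one_third_pow_three (by positivity))

lemma abs_integral_fract_mul_deriv_f1_sub_le {x : ℝ} (hx : 1 ≤ x) :
    |(∫ t in (1 : ℝ)..x ^ ((1 : ℝ) / 4), Int.fract t * deriv (f1 x) t)
        - 6 ^ ((1 : ℝ) / 3) * ((riemannZeta (1 / 3)).re + 1 / 2) * x ^ ((1 : ℝ) / 3)|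
      ≤ (2 + 6 ^ ((1 : ℝ) / 3)) * x ^ ((1 : ℝ) / 4) := by
  have hx0 : 0 < x := by linarith
  have hT : 1 ≤ x ^ ((1 : ℝ) / 4) := one_le_rpow hx (by norm_num)
  have hT4 : (x ^ ((1 : ℝ) / 4)) ^ 4 = x := by
    rw [← rpow_natCast, ← rpow_mul hx0.le]
    norm_num
  have hTp : x ^ ((1 : ℝ) / 3) * (x ^ ((1 : ℝ) / 4)) ^ (-(1 / 3) : ℝ) = x ^ ((1 : ℝ) / 4) := by
    rw [← rpow_mul hx0.le, ← rpow_add hx0]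
    norm_num
  generalize x ^ ((1 : ℝ) / 4) = T at *
  set c : ℝ := 1 / 3 * (6 * x) ^ ((1 : ℝ) / 3) with hc
  have hc' : c = 1 / 3 * (6 ^ ((1 : ℝ) / 3) * x ^ ((1 : ℝ) / 3)) := by
    rw [hc, mul_rpow (by norm_num) hx0.le]
  have hbound : ∀ t ∈ uIoc 1 T,
      ‖Int.fract t * (deriv (f1 x) t + c * t ^ (-(4 / 3) : ℝ))‖ ≤ 2 := by
    intro t ht
    rw [uIoc_of_le hT] at ht
    have ht0 : 0 < t := zero_lt_one.trans ht.1
    have h := abs_deriv_f1_add_rpow_le ht0 ((pow_le_pow_left₀ ht0.le ht.2 4).trans_eq hT4)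
    rw [norm_mul, Real.norm_of_nonneg (Int.fract_nonneg t), Real.norm_eq_abs]
    exact (mul_le_of_le_one_left (abs_nonneg _) (Int.fract_lt_one t).le).trans h
  have hmeas : Measurable fun t ↦ Int.fract t * (deriv (f1 x) t + c * t ^ (-(4 / 3) : ℝ)) :=
    measurable_fract.mul ((measurable_deriv _).add (by fun_prop))
  have hint : IntervalIntegrable
      (fun t ↦ Int.fract t * (deriv (f1 x) t + c * t ^ (-(4 / 3) : ℝ))) volume 1 T := by
    refine (intervalIntegrable_const (c := (2 : ℝ))).mono_fun hmeas.aestronglyMeasurable ?_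
    filter_upwards [ae_restrict_mem measurableSet_uIoc] with t ht
    simpa using hbound t ht
  have hK1 := integrableOn_fract_mul_rpow (a := 1) (p := -(4 / 3)) one_pos (by norm_num)
  have hKT := integrableOn_fract_mul_rpow (a := T) (p := -(4 / 3)) (by linarith) (by norm_num)
  have hJ : IntervalIntegrable (fun t : ℝ ↦ Int.fract t * t ^ (-(4 / 3) : ℝ)) volume 1 T := by
    rw [intervalIntegrable_iff_integrableOn_Ioc_of_le hT]
    exact hK1.mono_set Ioc_subset_Ioi_self
  have hsplit : ∫ t in (1 : ℝ)..T, Int.fract t * deriv (f1 x) t =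
      (∫ t in (1 : ℝ)..T, Int.fract t * (deriv (f1 x) t + c * t ^ (-(4 / 3) : ℝ))) -
        c * ∫ t in (1 : ℝ)..T, Int.fract t * t ^ (-(4 / 3) : ℝ) := by
    rw [← intervalIntegral.integral_const_mul, ← intervalIntegral.integral_sub hint (hJ.const_mul c)]
    congr 1 with t
    ring
  have hadd := intervalIntegral.integral_interval_add_Ioi hK1 hKT
  have htail := abs_integral_Ioi_fract_mul_rpow_le (a := T) (by linarith)
  have hmain := intervalIntegral.norm_integral_le_of_norm_le_const hbound
  rw [Real.norm_eq_abs, abs_of_nonneg (by linarith : 0 ≤ T - 1)] at hmain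
  rw [hsplit, riemannZeta_one_third_re, ← hadd]
  have hc0 : 0 ≤ c := by positivity
  have hct := mul_le_mul_of_nonneg_left htail hc0
  rw [← abs_of_nonneg hc0, ← abs_mul, abs_of_nonneg hc0] at hct
  have hce : c * (3 * T ^ (-(1 / 3) : ℝ)) = 6 ^ ((1 : ℝ) / 3) * T := by
    rw [hc']
    linear_combination 6 ^ ((1 : ℝ) / 3) * hTp
  rw [hce] at hct
  generalize (∫ t in (1 : ℝ)..T, Int.fract t * (deriv (f1 x) t + c * t ^ (-(4 / 3) : ℝ))) = D at *
  generalize (∫ t in (1 : ℝ)..T, Int.fract t * t ^ (-(4 / 3) : ℝ)) = J at *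
  generalize (∫ t in Ioi T, Int.fract t * t ^ (-(4 / 3) : ℝ)) = R at *
  have he : D - c * J - 6 ^ ((1 : ℝ) / 3) * (-(1 / 2) - 1 / 3 * (J + R) + 1 / 2) *
      x ^ ((1 : ℝ) / 3) = D + c * R := by
    linear_combination -(J + R) * hc'
  rw [he]
  refine (abs_add_le _ _).trans ?_
  linarith

theorem integral_fract_f1_deriv_asymptotic :
    (fun x : ℝ => (∫ t in (1:ℝ)..x ^ ((1:ℝ)/4), Int.fract t * deriv (f1 x) t)
        - 6 ^ ((1:ℝ)/3) * ((riemannZeta (1/3)).re + 1/2) * x ^ ((1:ℝ)/3))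
      =O[atTop] fun x : ℝ => x ^ ((1:ℝ)/4) := by
  refine IsBigO.of_bound (2 + 6 ^ ((1 : ℝ) / 3)) ?_
  filter_upwards [eventually_ge_atTop 1] with x hx
  rw [Real.norm_eq_abs, Real.norm_of_nonneg (rpow_nonneg (by linarith) _)]
  exact abs_integral_fract_mul_deriv_f1_sub_le hx
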